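/- arXiv:2109.08967 — 10 statements merged into one kernel-verified Lean document; each statement's English description precedes it below -/
import Mathlib

section
/- Let n ≥ 2 and let k be an integer with 2 ≤ k ≤ n. Let e : {1,…,n−1} → ℝ satisfy 0 < e_i < k/n for every i ∈ {1,…,n−1}. Then p_E(n−1, k−1) − p_E(n−1, k) > 0, i.e. the Poisson binomial probability of exactly k−1 errors among the n−1 classifiers strictly exceeds that of exactly k errors. -/
/-- Poisson binomial probability: the probability that exactly `k` of the
classifiers indexed by `S` make an error, where classifier `i` errs with
probability `e i`. -/
noncomputable def pE (S : Finset ℕ) (e : ℕ → ℝ) (k : ℕ) : ℝ :=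
  ∑ A ∈ S.powerset.filter (fun A => A.card = k),
    (∏ i ∈ A, e i) * ∏ j ∈ S \ A, (1 - e j)

theorem pE_eq_sum_powerset (S : Finset ℕ) (e : ℕ → ℝ) (k : ℕ) :
    pE S e k = ∑ A ∈ S.powerset,
      ((∏ i ∈ A, e i) * ∏ j ∈ S \ A, (1 - e j)) * if A.card = k then 1 else 0 := by
  simp [pE, Finset.sum_filter]

/-- Conditioning on the outcome of one trial `a`. -/
theorem sum_powerset_insert_bernoulli {S : Finset ℕ} {a : ℕ} (ha : a ∉ S) (u : ℕ → ℝ)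
    (φ : ℕ → ℝ) :
    ∑ A ∈ (insert a S).powerset,
        ((∏ i ∈ A, u i) * ∏ j ∈ insert a S \ A, (1 - u j)) * φ A.card =
      (1 - u a) * ∑ A ∈ S.powerset,
          ((∏ i ∈ A, u i) * ∏ j ∈ S \ A, (1 - u j)) * φ A.card +
        u a * ∑ A ∈ S.powerset,
          ((∏ i ∈ A, u i) * ∏ j ∈ S \ A, (1 - u j)) * φ (A.card + 1) := by
  rw [Finset.sum_powerset_insert ha, Finset.mul_sum, Finset.mul_sum]
  congr 1 <;> refine Finset.sum_congr rfl fun A hA => ?_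
  · have haA : a ∉ A := fun h => ha (Finset.mem_powerset.1 hA h)
    rw [Finset.insert_sdiff_of_notMem _ haA, Finset.prod_insert (by simp [ha])]
    ring
  · have haA : a ∉ A := fun h => ha (Finset.mem_powerset.1 hA h)
    rw [Finset.insert_sdiff_insert, Finset.sdiff_insert_of_notMem ha, Finset.prod_insert haA,
      Finset.card_insert_of_notMem haA]
    ring

/-- The probability of exactly `k` successes in `j` independent trials of success
probability `c`. -/
noncomputable def binomialProb (c : ℝ) (k j : ℕ) : ℝ :=
  (j.choose k : ℝ) * c ^ k * (1 - c) ^ (j - k)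

theorem binomialProb_succ_succ (c : ℝ) (k j : ℕ) :
    binomialProb c (k + 1) (j + 1) =
      c * binomialProb c k j + (1 - c) * binomialProb c (k + 1) j := by
  unfold binomialProb
  rw [Nat.choose_succ_succ, Nat.add_sub_add_right]
  rcases lt_or_ge k j with h | h
  · obtain ⟨m, rfl⟩ := Nat.exists_eq_add_of_lt h
    rw [show k + m + 1 - k = m + 1 by omega, show k + m + 1 - (k + 1) = m by omega]
    push_cast
    ring
  · rw [Nat.choose_eq_zero_of_lt (Nat.lt_succ_of_le h)]
    push_cast
    ring

theorem binomialProb_zero_succ (c : ℝ) (j : ℕ) :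
    binomialProb c 0 (j + 1) = (1 - c) * binomialProb c 0 j := by
  simp [binomialProb, pow_succ, mul_comm]

/-- Thinning: trials with success probabilities `c * u i` arise by keeping each success of
trials with success probabilities `u i` independently with probability `c`. -/
theorem pE_const_mul (S : Finset ℕ) (c : ℝ) (u : ℕ → ℝ) (k : ℕ) :
    pE S (fun i => c * u i) k = ∑ A ∈ S.powerset,
      ((∏ i ∈ A, u i) * ∏ j ∈ S \ A, (1 - u j)) * binomialProb c k A.card := by
  induction S using Finset.induction_on generalizing k with
  | empty => cases k <;> simp [pE_eq_sum_powerset, binomialProb]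
  | insert a S ha ih =>
    rw [pE_eq_sum_powerset,
      sum_powerset_insert_bernoulli ha (fun i => c * u i) (fun m => if m = k then 1 else 0),
      sum_powerset_insert_bernoulli ha u, ← pE_eq_sum_powerset, ← ih]
    cases k with
    | zero =>
      simp only [binomialProb_zero_succ, mul_left_comm _ (1 - c), ← Finset.mul_sum, ← ih]
      simp
      ring
    | succ k =>
      simp only [binomialProb_succ_succ, mul_add, Finset.sum_add_distrib, mul_left_comm _ (1 - c),
        mul_left_comm _ c, ← Finset.mul_sum, ← ih, add_left_inj, ← pE_eq_sum_powerset]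
      ring

theorem binomialProb_succ_le {c : ℝ} (hc0 : 0 ≤ c) (hc1 : c ≤ 1) {r j : ℕ}
    (h : c * (j + 1) ≤ r + 1) : binomialProb c (r + 1) j ≤ binomialProb c r j := by
  have h1c : 0 ≤ 1 - c := sub_nonneg.2 hc1
  rcases lt_or_ge r j with hj | hj
  · obtain ⟨m, rfl⟩ := Nat.exists_eq_add_of_lt hj
    have hch : (((r + m + 1).choose (r + 1) : ℕ) : ℝ) * (r + 1) =
        ((r + m + 1).choose r : ℕ) * (m + 1) := by
      have := Nat.choose_succ_right_eq (r + m + 1) r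
      rw [show r + m + 1 - r = m + 1 by omega] at this
      exact_mod_cast this
    unfold binomialProb
    rw [show r + m + 1 - r = m + 1 by omega, show r + m + 1 - (r + 1) = m by omega]
    push_cast at h
    have hr : (0 : ℝ) < r + 1 := by positivity
    refine le_of_mul_le_mul_right ?_ hr
    have hnn : 0 ≤ ((r + m + 1).choose r : ℝ) * c ^ r * (1 - c) ^ m *
        (r + 1 - c * (r + m + 1 + 1)) :=
      mul_nonneg (by positivity) (by linarith)
    linear_combination hnn + c ^ (r + 1) * (1 - c) ^ m * hch
  · rw [binomialProb, Nat.choose_eq_zero_of_lt (Nat.lt_succ_of_le hj)]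
    unfold binomialProb
    simp only [Nat.cast_zero, zero_mul]
    positivity

theorem stmt0 (n : ℕ) (hn : 2 ≤ n) (k : ℕ) (hk2 : 2 ≤ k) (hkn : k ≤ n)
    (e : ℕ → ℝ) (he : ∀ i ∈ Finset.Icc 1 (n - 1), 0 < e i ∧ e i < (k : ℝ) / n) :
    pE (Finset.Icc 1 (n - 1)) e (k - 1) - pE (Finset.Icc 1 (n - 1)) e k > 0 := by
  obtain ⟨r, rfl⟩ : ∃ r, k = r + 1 := ⟨k - 1, by omega⟩
  rw [Nat.add_sub_cancel]
  set S := Finset.Icc 1 (n - 1) with hS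
  have hcard : S.card = n - 1 := by simp [hS]
  have hn0 : (0 : ℝ) < n := by exact_mod_cast (by omega : 0 < n)
  set c : ℝ := ((r + 1 : ℕ) : ℝ) / n with hc
  have hc0 : 0 < c := by positivity
  have hc1 : c ≤ 1 := (div_le_one hn0).2 (by exact_mod_cast hkn)
  have hcn : c * n = r + 1 := by rw [hc, div_mul_cancel₀ _ hn0.ne']; push_cast; rfl
  have heu : e = fun i => c * (e i / c) := by
    funext i
    rw [mul_div_cancel₀ _ hc0.ne']
  have hw : ∀ A ∈ S.powerset, 0 < (∏ i ∈ A, e i / c) * ∏ j ∈ S \ A, (1 - e j / c) := by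
    refine fun A hA => mul_pos (Finset.prod_pos fun i hi => ?_) (Finset.prod_pos fun i hi => ?_)
    · exact div_pos (he i (Finset.mem_powerset.1 hA hi)).1 hc0
    · exact sub_pos.2 ((div_lt_one hc0).2 (he i (Finset.mem_sdiff.1 hi).1).2)
  rw [gt_iff_lt, sub_pos, heu, pE_const_mul, pE_const_mul]
  refine Finset.sum_lt_sum (fun A hA => ?_) ?_
  · refine mul_le_mul_of_nonneg_left (binomialProb_succ_le hc0.le hc1 ?_) (hw A hA).le
    have hA' : A.card + 1 ≤ n := by
      have := Finset.card_le_card (Finset.mem_powerset.1 hA)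
      omega
    rw [← hcn]
    exact mul_le_mul_of_nonneg_left (by exact_mod_cast hA') hc0.le
  · obtain ⟨A, hAS, hAr⟩ := Finset.exists_subset_card_eq (show r ≤ S.card by omega)
    refine ⟨A, Finset.mem_powerset.2 hAS,
      mul_lt_mul_of_pos_left ?_ (hw A (Finset.mem_powerset.2 hAS))⟩
    simp only [hAr, binomialProb, Nat.choose_succ_self, Nat.choose_self, Nat.sub_self]
    simpa using pow_pos hc0 r
end

section
/- Let n ≥ 1 and let k be an integer with 1 ≤ k ≤ n. Let e, e' : {1,…,n} → ℝ satisfy 0 < e_i < k/n and 0 < e'_i < k/n for all i, and suppose there is an index m such that e_m < e'_m while e_i = e'_i for all i ≠ m. Then p_E(n,k) < p_{E'}(n,k); that is, the Poisson binomial probability of exactly k errors is strictly increasing in each error rate e_m over the interval (0, k/n). -/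
lemma pE_eq_sum_powersetCard (S : Finset ℕ) (e : ℕ → ℝ) (k : ℕ) :
    pE S e k = ∑ A ∈ S.powersetCard k, (∏ i ∈ A, e i) * ∏ j ∈ S \ A, (1 - e j) := by
  rw [pE, Finset.powersetCard_eq_filter]

lemma pE_congr {S : Finset ℕ} {e e' : ℕ → ℝ} (h : ∀ i ∈ S, e i = e' i) (k : ℕ) :
    pE S e k = pE S e' k := by
  refine Finset.sum_congr rfl fun A hA => ?_
  have hAS : A ⊆ S := Finset.mem_powerset.mp (Finset.mem_filter.mp hA).1
  rw [Finset.prod_congr rfl fun i hi => h i (hAS hi)]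
  congr 1
  exact Finset.prod_congr rfl fun i hi => by rw [h i (Finset.mem_sdiff.mp hi).1]

/-- Conditioning on whether the classifier `m` errs. -/
lemma pE_insert_succ {T : Finset ℕ} {m : ℕ} (hm : m ∉ T) (e : ℕ → ℝ) (k : ℕ) :
    pE (insert m T) e (k + 1) = e m * pE T e k + (1 - e m) * pE T e (k + 1) := by
  simp only [pE_eq_sum_powersetCard]
  rw [Finset.powersetCard_succ_insert hm, Finset.sum_union, Finset.sum_image, add_comm,
    Finset.mul_sum, Finset.mul_sum]
  · congr 1
    · refine Finset.sum_congr rfl fun A hA => ?_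
      have hmA : m ∉ A := fun h => hm ((Finset.mem_powersetCard.mp hA).1 h)
      rw [Finset.prod_insert hmA, Finset.insert_sdiff_insert, Finset.sdiff_insert_of_notMem hm,
        mul_assoc]
    · refine Finset.sum_congr rfl fun A hA => ?_
      have hmA : m ∉ A := fun h => hm ((Finset.mem_powersetCard.mp hA).1 h)
      rw [Finset.insert_sdiff_of_notMem _ hmA,
        Finset.prod_insert fun h => hm (Finset.mem_sdiff.mp h).1]
      ring
  · intro A hA B hB hAB
    have hmA : m ∉ A := fun h => hm ((Finset.mem_powersetCard.mp hA).1 h)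
    have hmB : m ∉ B := fun h => hm ((Finset.mem_powersetCard.mp hB).1 h)
    rw [← Finset.erase_insert hmA, ← Finset.erase_insert hmB]
    exact congrArg (Finset.erase · m) hAB
  · rw [Finset.disjoint_left]
    intro A hA hA'
    obtain ⟨B, -, rfl⟩ := Finset.mem_image.mp hA'
    exact hm ((Finset.mem_powersetCard.mp hA).1 (Finset.mem_insert_self m B))

/-- Double counting of the pairs `B ⊂ insert i B` of subsets of sizes `k` and `k + 1`. -/
lemma succ_mul_sum_powersetCard_succ (T : Finset ℕ) (k : ℕ) (f : Finset ℕ → ℝ) :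
    ((k : ℝ) + 1) * ∑ A ∈ T.powersetCard (k + 1), f A =
      ∑ B ∈ T.powersetCard k, ∑ i ∈ T \ B, f (insert i B) := by
  have hcount : ((k : ℝ) + 1) * ∑ A ∈ T.powersetCard (k + 1), f A =
      ∑ A ∈ T.powersetCard (k + 1), ∑ _i ∈ A, f A := by
    rw [Finset.mul_sum]
    refine Finset.sum_congr rfl fun A hA => ?_
    rw [Finset.sum_const, (Finset.mem_powersetCard.mp hA).2, nsmul_eq_mul]
    push_cast
    rfl
  rw [hcount, Finset.sum_sigma', Finset.sum_sigma']
  refine Finset.sum_bij' (fun x _ => ⟨x.1.erase x.2, x.2⟩) (fun x _ => ⟨insert x.2 x.1, x.2⟩)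
    ?_ ?_ ?_ ?_ ?_
  · rintro ⟨A, i⟩ h
    simp only [Finset.mem_sigma, Finset.mem_powersetCard, Finset.mem_sdiff] at h ⊢
    obtain ⟨⟨hA, hc⟩, hi⟩ := h
    refine ⟨⟨(Finset.erase_subset _ _).trans hA, ?_⟩, hA hi, Finset.notMem_erase _ _⟩
    rw [Finset.card_erase_of_mem hi, hc, Nat.add_sub_cancel]
  · rintro ⟨B, i⟩ h
    simp only [Finset.mem_sigma, Finset.mem_powersetCard, Finset.mem_sdiff] at h ⊢
    obtain ⟨⟨hB, hc⟩, hi, hiB⟩ := h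
    refine ⟨⟨Finset.insert_subset hi hB, ?_⟩, Finset.mem_insert_self _ _⟩
    rw [Finset.card_insert_of_notMem hiB, hc]
  · rintro ⟨A, i⟩ h
    simp only [Finset.mem_sigma] at h
    simp [Finset.insert_erase h.2]
  · rintro ⟨B, i⟩ h
    simp only [Finset.mem_sigma, Finset.mem_sdiff] at h
    simp [Finset.erase_insert h.2.2]
  · rintro ⟨A, i⟩ h
    simp only [Finset.mem_sigma] at h
    simp [Finset.insert_erase h.2]

/-- If every error rate is below `(k + 1) / (|T| + 1)`, then `k` errors are strictly more likely
than `k + 1` errors. -/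
lemma pE_succ_lt {T : Finset ℕ} {e : ℕ → ℝ} {k : ℕ} (hk : k ≤ T.card)
    (he : ∀ i ∈ T, 0 < e i ∧ e i < ((k : ℝ) + 1) / (T.card + 1)) :
    pE T e (k + 1) < pE T e k := by
  have hkR : (k : ℝ) ≤ T.card := by exact_mod_cast hk
  have hone : ∀ i ∈ T, 0 < 1 - e i := fun i hi => by
    have : ((k : ℝ) + 1) / (T.card + 1) ≤ 1 := by
      rw [div_le_one (by positivity)]
      linarith
    linarith [(he i hi).2]
  have hpos : ∀ A ⊆ T, 0 < (∏ i ∈ A, e i) * ∏ j ∈ T \ A, (1 - e j) := fun A hA =>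
    mul_pos (Finset.prod_pos fun i hi => (he i (hA hi)).1)
      (Finset.prod_pos fun i hi => hone i (Finset.mem_sdiff.mp hi).1)
  have hne : (T.powersetCard k).Nonempty := Finset.powersetCard_nonempty.mpr hk
  simp only [pE_eq_sum_powersetCard]
  rcases hk.eq_or_lt with hk | hk
  · rw [Finset.powersetCard_eq_empty.mpr (by omega : T.card < k + 1), Finset.sum_empty]
    exact Finset.sum_pos (fun A hA => hpos A (Finset.mem_powersetCard.mp hA).1) hne
  have hd : (0 : ℝ) < T.card - k := by
    rw [sub_pos]
    exact_mod_cast hk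
  have hstep : ∀ B ⊆ T, ∀ i ∈ T \ B,
      (T.card - k : ℝ) * ((∏ a ∈ insert i B, e a) * ∏ j ∈ T \ insert i B, (1 - e j)) <
        ((k : ℝ) + 1) * ((∏ a ∈ B, e a) * ∏ j ∈ T \ B, (1 - e j)) := by
    intro B hB i hi
    obtain ⟨hiT, hiB⟩ := Finset.mem_sdiff.mp hi
    have hodds : (T.card - k : ℝ) * e i < (k + 1) * (1 - e i) := by
      have := (lt_div_iff₀ (by positivity)).mp (he i hiT).2
      linarith
    have hw : 0 < (∏ a ∈ B, e a) * ∏ j ∈ T \ insert i B, (1 - e j) :=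
      mul_pos (Finset.prod_pos fun a ha => (he a (hB ha)).1)
        (Finset.prod_pos fun j hj => hone j (Finset.mem_sdiff.mp hj).1)
    rw [Finset.prod_insert hiB, ← Finset.mul_prod_erase (T \ B) _ hi, ← Finset.sdiff_insert]
    calc _ = ((T.card - k : ℝ) * e i) * ((∏ a ∈ B, e a) * ∏ j ∈ T \ insert i B, (1 - e j)) := by
          ring
      _ < ((k + 1) * (1 - e i)) * ((∏ a ∈ B, e a) * ∏ j ∈ T \ insert i B, (1 - e j)) :=
          mul_lt_mul_of_pos_right hodds hw
      _ = _ := by ring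
  have hcard : ∀ B ∈ T.powersetCard k, ((T \ B).card : ℝ) = T.card - k := fun B hB => by
    obtain ⟨hBT, hBk⟩ := Finset.mem_powersetCard.mp hB
    rw [Finset.card_sdiff_of_subset hBT, hBk, Nat.cast_sub hk.le]
  have hc : (0 : ℝ) < (T.card - k) * (k + 1) := by positivity
  refine lt_of_mul_lt_mul_left ?_ hc.le
  rw [mul_assoc, succ_mul_sum_powersetCard_succ, Finset.mul_sum, Finset.mul_sum]
  refine Finset.sum_lt_sum_of_nonempty hne fun B hB => ?_
  have hBT := (Finset.mem_powersetCard.mp hB).1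
  have hBne : (T \ B).Nonempty := by
    rw [← Finset.card_pos, ← Nat.cast_pos (α := ℝ), hcard B hB]
    exact hd
  rw [Finset.mul_sum, mul_assoc, ← hcard B hB, ← nsmul_eq_mul (T \ B).card, ← Finset.sum_const,
    hcard B hB]
  exact Finset.sum_lt_sum_of_nonempty hBne (hstep B hBT)

theorem stmt2 (n : ℕ) (hn : 1 ≤ n) (k : ℕ) (hk1 : 1 ≤ k) (hkn : k ≤ n)
    (e e' : ℕ → ℝ)
    (he : ∀ i ∈ Finset.Icc 1 n, 0 < e i ∧ e i < (k : ℝ) / n)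
    (he' : ∀ i ∈ Finset.Icc 1 n, 0 < e' i ∧ e' i < (k : ℝ) / n)
    (m : ℕ) (hm : m ∈ Finset.Icc 1 n) (hlt : e m < e' m)
    (heq : ∀ i, i ≠ m → e i = e' i) :
    pE (Finset.Icc 1 n) e k < pE (Finset.Icc 1 n) e' k := by
  obtain ⟨j, rfl⟩ : ∃ j, k = j + 1 := ⟨k - 1, by omega⟩
  have hmT : m ∉ (Finset.Icc 1 n).erase m := Finset.notMem_erase _ _
  have hcard : ((Finset.Icc 1 n).erase m).card + 1 = n := by
    rw [Finset.card_erase_add_one hm, Nat.card_Icc, Nat.add_sub_cancel]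
  have hlt' : pE ((Finset.Icc 1 n).erase m) e (j + 1) < pE ((Finset.Icc 1 n).erase m) e j := by
    refine pE_succ_lt (by omega) fun i hi => ?_
    have := he i (Finset.mem_of_mem_erase hi)
    rw [← hcard] at this
    push_cast at this
    exact this
  have hcongr := pE_congr (e := e) (e' := e') (S := (Finset.Icc 1 n).erase m)
    fun i hi => heq i (Finset.ne_of_mem_erase hi)
  rw [← Finset.insert_erase hm, pE_insert_succ hmT, pE_insert_succ hmT, ← hcongr, ← hcongr]
  nlinarith [mul_pos (sub_pos.mpr hlt) (sub_pos.mpr hlt')]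
end

section
/- Let n, m ∈ ℕ with 0 < m < n, and let e : {1,…,n} → ℝ satisfy 0 ≤ e_i ≤ m/n for all i. Set e_max = max_i e_i. Then ε_E(n,m) ≤ ε(n,m,e_max), i.e. the Poisson binomial tail probability of at least m errors is at most the corresponding binomial tail probability with parameter e_max. -/
/-- Binomial probability `C(N,k) ē^k (1-ē)^(N-k)`. -/
noncomputable def pBin (N k : ℕ) (eb : ℝ) : ℝ :=
  (N.choose k : ℝ) * eb ^ k * (1 - eb) ^ (N - k)

/-- Poisson binomial tail probability: at least `m` errors among the
classifiers indexed by `{1, …, n}`. -/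
noncomputable def epsE (n : ℕ) (e : ℕ → ℝ) (m : ℕ) : ℝ :=
  ∑ k ∈ Finset.Icc m n, pE (Finset.Icc 1 n) e k

/-- Binomial tail probability: at least `m` errors out of `n`. -/
noncomputable def epsBin (n m : ℕ) (eb : ℝ) : ℝ :=
  ∑ k ∈ Finset.Icc m n, pBin n k eb

/-- The probability that at least `m` of the classifiers indexed by `S` make an error. -/
noncomputable def poissonBinomialTail (S : Finset ℕ) (e : ℕ → ℝ) (m : ℕ) : ℝ :=
  ∑ A ∈ S.powerset, if m ≤ A.card then (∏ i ∈ A, e i) * ∏ j ∈ S \ A, (1 - e j) else 0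

theorem poissonBinomialTail_insert {a : ℕ} {S : Finset ℕ} (ha : a ∉ S) (e : ℕ → ℝ) (m : ℕ) :
    poissonBinomialTail (insert a S) e m =
      (1 - e a) * poissonBinomialTail S e m + e a * poissonBinomialTail S e (m - 1) := by
  unfold poissonBinomialTail
  rw [Finset.sum_powerset_insert ha, Finset.mul_sum, Finset.mul_sum]
  congr 1
  · refine Finset.sum_congr rfl fun A hA => ?_
    have hA' : a ∉ A := fun h => ha (Finset.mem_powerset.1 hA h)
    rw [Finset.insert_sdiff_of_notMem _ hA', Finset.prod_insert (by simp [ha])]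
    split_ifs <;> ring
  · refine Finset.sum_congr rfl fun A hA => ?_
    have hA' : a ∉ A := fun h => ha (Finset.mem_powerset.1 hA h)
    have hS : insert a S \ insert a A = S \ A := by
      ext x
      simp only [Finset.mem_sdiff, Finset.mem_insert]
      grind
    have hcard : m ≤ A.card + 1 ↔ m - 1 ≤ A.card := by omega
    rw [hS, Finset.prod_insert hA', Finset.card_insert_of_notMem hA']
    simp only [hcard]
    split_ifs <;> ring

theorem poissonBinomialTail_antitone {S : Finset ℕ} {e : ℕ → ℝ}
    (h0 : ∀ i ∈ S, 0 ≤ e i) (h1 : ∀ i ∈ S, e i ≤ 1) :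
    Antitone (poissonBinomialTail S e) := by
  intro m k hmk
  refine Finset.sum_le_sum fun A hA => ?_
  have hA' := Finset.mem_powerset.1 hA
  have hw : 0 ≤ (∏ i ∈ A, e i) * ∏ j ∈ S \ A, (1 - e j) :=
    mul_nonneg (Finset.prod_nonneg fun i hi => h0 i (hA' hi))
      (Finset.prod_nonneg fun j hj => sub_nonneg.2 (h1 j (Finset.mem_sdiff.1 hj).1))
  split_ifs
  · exact le_rfl
  · omega
  · exact hw
  · exact le_rfl

theorem poissonBinomialTail_mono {S : Finset ℕ} {e f : ℕ → ℝ} (h0 : ∀ i ∈ S, 0 ≤ e i)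
    (hef : ∀ i ∈ S, e i ≤ f i) (h1 : ∀ i ∈ S, f i ≤ 1) (m : ℕ) :
    poissonBinomialTail S e m ≤ poissonBinomialTail S f m := by
  induction S using Finset.induction_on generalizing m with
  | empty => simp [poissonBinomialTail]
  | insert a S ha ih =>
    simp only [Finset.forall_mem_insert] at h0 hef h1
    rw [poissonBinomialTail_insert ha, poissonBinomialTail_insert ha]
    have ih' := ih h0.2 hef.2 h1.2
    have hanti : poissonBinomialTail S f m ≤ poissonBinomialTail S f (m - 1) :=
      poissonBinomialTail_antitone (fun i hi => (h0.2 i hi).trans (hef.2 i hi)) h1.2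
        (Nat.sub_le m 1)
    calc _ ≤ (1 - e a) * poissonBinomialTail S f m + e a * poissonBinomialTail S f (m - 1) :=
          add_le_add
            (mul_le_mul_of_nonneg_left (ih' m) (sub_nonneg.2 (hef.1.trans h1.1)))
            (mul_le_mul_of_nonneg_left (ih' (m - 1)) h0.1)
      _ ≤ _ := by nlinarith [mul_nonneg (sub_nonneg.2 hef.1) (sub_nonneg.2 hanti)]

theorem epsE_eq_poissonBinomialTail (n : ℕ) (e : ℕ → ℝ) (m : ℕ) :
    epsE n e m = poissonBinomialTail (Finset.Icc 1 n) e m := by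
  unfold epsE pE poissonBinomialTail
  simp only [Finset.sum_filter]
  rw [Finset.sum_comm]
  refine Finset.sum_congr rfl fun A hA => ?_
  have hcard : A.card ≤ n := by
    simpa using Finset.card_le_card (Finset.mem_powerset.1 hA)
  rw [Finset.sum_ite_eq]
  simp [hcard]

theorem pE_const (n k : ℕ) (p : ℝ) : pE (Finset.Icc 1 n) (fun _ => p) k = pBin n k p := by
  unfold pE pBin
  rw [← Finset.powersetCard_eq_filter]
  rw [Finset.sum_congr rfl (g := fun _ => p ^ k * (1 - p) ^ (n - k))]
  · simp [mul_assoc]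
  · intro A hA
    obtain ⟨hS, hk⟩ := Finset.mem_powersetCard.1 hA
    simp [Finset.card_sdiff_of_subset hS, hk]

theorem epsE_const (n m : ℕ) (p : ℝ) : epsE n (fun _ => p) m = epsBin n m p :=
  Finset.sum_congr rfl fun k _ => pE_const n k p

theorem stmt4 (n m : ℕ) (hm : 0 < m) (hmn : m < n)
    (e : ℕ → ℝ) (he : ∀ i ∈ Finset.Icc 1 n, 0 ≤ e i ∧ e i ≤ (m : ℝ) / n)
    (emax : ℝ) (hub : ∀ i ∈ Finset.Icc 1 n, e i ≤ emax)
    (hmem : ∃ i ∈ Finset.Icc 1 n, e i = emax) :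
    epsE n e m ≤ epsBin n m emax := by
  have hmax : emax ≤ 1 := by
    obtain ⟨i, hi, rfl⟩ := hmem
    exact (he i hi).2.trans (div_le_one_of_le₀ (by exact_mod_cast hmn.le) n.cast_nonneg)
  rw [← epsE_const, epsE_eq_poissonBinomialTail, epsE_eq_poissonBinomialTail]
  exact poissonBinomialTail_mono (fun i hi => (he i hi).1) hub (fun _ _ => hmax) m
end

section
/- (Feller's bound) Let n, m ∈ ℕ with 1 ≤ m ≤ n and let ē ∈ ℝ with 0 ≤ ē < 1 and m > n·ē. Then the binomial tail satisfies ε(n,m,ē) = Σ_{k=m}^{n} C(n,k) ē^k (1−ē)^{n−k} ≤ m(1−ē)/(m − nē)². -/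
theorem pBin_nonneg (N k : ℕ) {eb : ℝ} (h0 : 0 ≤ eb) (h1 : eb ≤ 1) : 0 ≤ pBin N k eb := by
  have : 0 ≤ 1 - eb := sub_nonneg.2 h1
  unfold pBin
  positivity

/-- The variance of the binomial distribution. -/
theorem sum_sq_mul_pBin (n : ℕ) (eb : ℝ) :
    ∑ k ∈ Finset.range (n + 1), ((n : ℝ) * eb - k) ^ 2 * pBin n k eb = n * eb * (1 - eb) := by
  have h := congrArg (Polynomial.eval eb) (bernsteinPolynomial.variance ℝ n)
  simpa [Polynomial.eval_finsetSum, bernsteinPolynomial, pBin] using h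

/-- Chebyshev's inequality for the binomial tail. -/
theorem epsBin_mul_sq_le (n m : ℕ) {eb : ℝ} (h0 : 0 ≤ eb) (h1 : eb ≤ 1) (h : (n : ℝ) * eb ≤ m) :
    epsBin n m eb * ((m : ℝ) - n * eb) ^ 2 ≤ n * eb * (1 - eb) := by
  rw [← sum_sq_mul_pBin, epsBin, Finset.sum_mul]
  calc ∑ k ∈ Finset.Icc m n, pBin n k eb * ((m : ℝ) - n * eb) ^ 2
      ≤ ∑ k ∈ Finset.Icc m n, ((n : ℝ) * eb - k) ^ 2 * pBin n k eb := by
        refine Finset.sum_le_sum fun k hk => ?_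
        have hmk : (m : ℝ) ≤ k := by exact_mod_cast (Finset.mem_Icc.1 hk).1
        rw [mul_comm]
        refine mul_le_mul_of_nonneg_right ?_ (pBin_nonneg n k h0 h1)
        nlinarith
    _ ≤ ∑ k ∈ Finset.range (n + 1), ((n : ℝ) * eb - k) ^ 2 * pBin n k eb := by
        refine Finset.sum_le_sum_of_subset_of_nonneg (fun k hk => ?_) fun k _ _ =>
          mul_nonneg (sq_nonneg _) (pBin_nonneg n k h0 h1)
        rw [Finset.mem_range]
        exact Nat.lt_succ_of_le (Finset.mem_Icc.1 hk).2

/-- Feller's bound on the binomial tail. -/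
theorem stmt5 (n m : ℕ) (hm1 : 1 ≤ m) (hmn : m ≤ n) (eb : ℝ)
    (heb0 : 0 ≤ eb) (heb1 : eb < 1) (h : (n : ℝ) * eb < m) :
    epsBin n m eb ≤ (m : ℝ) * (1 - eb) / ((m : ℝ) - n * eb) ^ 2 := by
  rw [le_div_iff₀ (pow_pos (sub_pos.2 h) 2)]
  exact (epsBin_mul_sq_le n m heb0 heb1.le h.le).trans
    (mul_le_mul_of_nonneg_right h.le (sub_nonneg.2 heb1.le))
end

section
/- Let n, m ∈ ℕ with 0 < m < n, set r = m/n, and let ê ∈ ℝ with 0 ≤ ê < r. Let e : {1,…,n} → ℝ satisfy 0 ≤ e_i ≤ ê for all i. Then ε_E(n,m) ≤ (1/n) · r(1 − ê)/(r − ê)². In particular, if r and ê are held fixed, the Poisson binomial tail ε_E(n,m) tends to 0 as n → ∞. -/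
/-- The probability that exactly the classifiers in `A ⊆ S` make an error. -/
noncomputable def errorWeight (S : Finset ℕ) (e : ℕ → ℝ) (A : Finset ℕ) : ℝ :=
  (∏ i ∈ A, e i) * ∏ j ∈ S \ A, (1 - e j)

lemma errorWeight_nonneg {S : Finset ℕ} {e : ℕ → ℝ} (he : ∀ i ∈ S, 0 ≤ e i ∧ e i ≤ 1)
    {A : Finset ℕ} (hA : A ⊆ S) : 0 ≤ errorWeight S e A :=
  mul_nonneg (Finset.prod_nonneg fun i hi => (he i (hA hi)).1)
    (Finset.prod_nonneg fun j hj => sub_nonneg.2 (he j (Finset.sdiff_subset hj)).2)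

/-- Bias-variance decomposition of the number of errors about a point `c`. -/
lemma sum_errorWeight_mul_sq (S : Finset ℕ) (e : ℕ → ℝ) (c : ℝ) :
    ∑ A ∈ S.powerset, errorWeight S e A * ((A.card : ℝ) - c) ^ 2 =
      ∑ i ∈ S, e i * (1 - e i) + (∑ i ∈ S, e i - c) ^ 2 := by
  induction S using Finset.induction_on generalizing c with
  | empty => simp [errorWeight]
  | insert a S ha ih =>
    have h_without : ∀ A ∈ S.powerset,
        errorWeight (insert a S) e A * ((A.card : ℝ) - c) ^ 2 =
          (1 - e a) * (errorWeight S e A * ((A.card : ℝ) - c) ^ 2) := by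
      intro A hA
      have haA : a ∉ A := fun h => ha (Finset.mem_powerset.1 hA h)
      rw [errorWeight, Finset.insert_sdiff_of_notMem _ haA,
        Finset.prod_insert (fun h => ha (Finset.sdiff_subset h)), errorWeight]
      ring
    have h_with : ∀ A ∈ S.powerset,
        errorWeight (insert a S) e (insert a A) * (((insert a A).card : ℝ) - c) ^ 2 =
          e a * (errorWeight S e A * ((A.card : ℝ) - (c - 1)) ^ 2) := by
      intro A hA
      have haA : a ∉ A := fun h => ha (Finset.mem_powerset.1 hA h)
      have h_sdiff : insert a S \ insert a A = S \ A := by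
        rw [Finset.insert_sdiff_insert, Finset.sdiff_insert_of_notMem ha]
      rw [errorWeight, h_sdiff, Finset.prod_insert haA, Finset.card_insert_of_notMem haA,
        errorWeight]
      push_cast
      ring
    rw [Finset.sum_powerset_insert ha, Finset.sum_congr rfl h_without,
      Finset.sum_congr rfl h_with, ← Finset.mul_sum, ← Finset.mul_sum, ih, ih,
      Finset.sum_insert ha, Finset.sum_insert ha]
    ring

lemma epsE_eq_sum_errorWeight (n m : ℕ) (e : ℕ → ℝ) :
    epsE n e m = ∑ A ∈ (Finset.Icc 1 n).powerset with m ≤ A.card,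
      errorWeight (Finset.Icc 1 n) e A := by
  have h_maps : ∀ A ∈ {A ∈ (Finset.Icc 1 n).powerset | m ≤ A.card},
      A.card ∈ Finset.Icc m n := by
    intro A hA
    rw [Finset.mem_filter, Finset.mem_powerset] at hA
    exact Finset.mem_Icc.2 ⟨hA.2, by simpa using Finset.card_le_card hA.1⟩
  rw [← Finset.sum_fiberwise_of_maps_to h_maps, epsE]
  refine Finset.sum_congr rfl fun k hk => ?_
  rw [pE, Finset.filter_filter]
  refine Finset.sum_congr (Finset.filter_congr fun A _ => ?_) fun _ _ => rfl
  exact ⟨fun h => ⟨h ▸ (Finset.mem_Icc.1 hk).1, h⟩, And.right⟩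

/-- Chebyshev's inequality for the upper tail of the Poisson binomial distribution. -/
lemma epsE_mul_sq_le_variance (n m : ℕ) (e : ℕ → ℝ)
    (he : ∀ i ∈ Finset.Icc 1 n, 0 ≤ e i ∧ e i ≤ 1)
    (h_mean : ∑ i ∈ Finset.Icc 1 n, e i ≤ m) :
    epsE n e m * ((m : ℝ) - ∑ i ∈ Finset.Icc 1 n, e i) ^ 2 ≤
      ∑ i ∈ Finset.Icc 1 n, e i * (1 - e i) := by
  set μ := ∑ i ∈ Finset.Icc 1 n, e i with hμ
  have h_moment := sum_errorWeight_mul_sq (Finset.Icc 1 n) e μ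
  rw [← hμ, sub_self, zero_pow two_ne_zero, add_zero] at h_moment
  rw [epsE_eq_sum_errorWeight, Finset.sum_mul, ← h_moment]
  refine (Finset.sum_le_sum fun A hA => ?_).trans
    (Finset.sum_le_sum_of_subset_of_nonneg (Finset.filter_subset _ _) fun A hA _ =>
      mul_nonneg (errorWeight_nonneg he (Finset.mem_powerset.1 hA)) (sq_nonneg _))
  rw [Finset.mem_filter, Finset.mem_powerset] at hA
  have h_card : (m : ℝ) ≤ A.card := by exact_mod_cast hA.2
  exact mul_le_mul_of_nonneg_left (pow_le_pow_left₀ (by linarith) (by linarith) 2)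
    (errorWeight_nonneg he hA.1)

lemma mul_one_sub_div_sq_le {x y r : ℝ} (hx : 0 ≤ x) (hxy : x ≤ y) (hyr : y < r) (hr : r ≤ 1) :
    x * (1 - x) / (r - x) ^ 2 ≤ r * (1 - y) / (r - y) ^ 2 := by
  rw [div_le_div_iff₀ (pow_pos (by linarith) 2) (pow_pos (by linarith) 2)]
  have h_cross : (1 - x) * (r - y) ≤ (1 - y) * (r - x) := by
    nlinarith [mul_nonneg (sub_nonneg.2 hxy) (sub_nonneg.2 hr)]
  calc x * (1 - x) * (r - y) ^ 2
      = x * ((1 - x) * (r - y) * (r - y)) := by ring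
    _ ≤ r * ((1 - y) * (r - x) * (r - x)) := by
        have hx1 : 0 ≤ (1 - x) * (r - y) := mul_nonneg (by linarith) (by linarith)
        have hy1 : 0 ≤ (1 - y) * (r - x) := hx1.trans h_cross
        exact mul_le_mul (by linarith)
          (mul_le_mul h_cross (by linarith) (by linarith) hy1)
          (mul_nonneg hx1 (by linarith)) (by linarith)
    _ = r * (1 - y) * (r - x) ^ 2 := by ring

theorem stmt6 (n m : ℕ) (hm : 0 < m) (hmn : m < n) (ehat : ℝ)
    (hhat0 : 0 ≤ ehat) (hhatr : ehat < (m : ℝ) / n)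
    (e : ℕ → ℝ) (he : ∀ i ∈ Finset.Icc 1 n, 0 ≤ e i ∧ e i ≤ ehat) :
    epsE n e m ≤ (1 / (n : ℝ)) *
      (((m : ℝ) / n) * (1 - ehat) / (((m : ℝ) / n) - ehat) ^ 2) := by
  have hn : (0 : ℝ) < n := by exact_mod_cast hm.trans hmn
  set r : ℝ := (m : ℝ) / n with hr
  have hr1 : r ≤ 1 := (div_le_one hn).2 (by exact_mod_cast hmn.le)
  set μ := ∑ i ∈ Finset.Icc 1 n, e i with hμ
  have hμ0 : 0 ≤ μ := Finset.sum_nonneg fun i hi => (he i hi).1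
  have hμ_le : μ ≤ n * ehat := by
    simpa using Finset.sum_le_card_nsmul (Finset.Icc 1 n) e ehat fun i hi => (he i hi).2
  have hx_le : μ / n ≤ ehat := (div_le_iff₀' hn).2 hμ_le
  have hx_lt : 0 < r - μ / n := by linarith
  have hm_eq : (m : ℝ) - μ = n * (r - μ / n) := by rw [hr]; field_simp
  have h_chebyshev := epsE_mul_sq_le_variance n m e
    (fun i hi => ⟨(he i hi).1, by linarith [(he i hi).2]⟩)
    (sub_nonneg.1 (hm_eq ▸ (mul_pos hn hx_lt).le))
  have h_variance : ∑ i ∈ Finset.Icc 1 n, e i * (1 - e i) ≤ n * (μ / n * (1 - μ / n)) := by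
    have h_sq : μ ^ 2 ≤ n * ∑ i ∈ Finset.Icc 1 n, e i ^ 2 := by
      simpa using sq_sum_le_card_mul_sum_sq (s := Finset.Icc 1 n) (f := e)
    have h_split : ∑ i ∈ Finset.Icc 1 n, e i * (1 - e i) =
        μ - ∑ i ∈ Finset.Icc 1 n, e i ^ 2 := by
      rw [hμ, ← Finset.sum_sub_distrib]
      exact Finset.sum_congr rfl fun i _ => by ring
    have h_mean : n * (μ / n * (1 - μ / n)) = μ - μ ^ 2 / n := by field_simp
    rw [h_split, h_mean]
    linarith [(div_le_iff₀' hn).2 h_sq]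
  rw [← hμ, hm_eq] at h_chebyshev
  calc epsE n e m
      ≤ n * (μ / n * (1 - μ / n)) / (n * (r - μ / n)) ^ 2 :=
        (le_div_iff₀ (pow_pos (mul_pos hn hx_lt) 2)).2 (h_chebyshev.trans h_variance)
    _ = 1 / n * (μ / n * (1 - μ / n) / (r - μ / n) ^ 2) := by
        generalize μ / n = x at *
        have := hx_lt.ne'
        field_simp
    _ ≤ 1 / n * (r * (1 - ehat) / (r - ehat) ^ 2) := by
        exact mul_le_mul_of_nonneg_left
          (mul_one_sub_div_sq_le (by positivity) hx_le hhatr hr1) (by positivity)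
end

section
/- (Chernoff bound for the Poisson binomial tail) Let n, m ∈ ℕ with 1 ≤ m ≤ n, and let e : {1,…,n} → ℝ satisfy 0 ≤ e_i ≤ 1 for all i. Set μ = Σ_{i=1}^{n} e_i and assume 0 < μ ≤ m. Then ε_E(n,m) ≤ e^{m−μ} · (μ/m)^m, where e denotes Euler's number. -/
/-- The probability generating function of the Poisson binomial distribution. -/
theorem sum_pow_mul_pE (S : Finset ℕ) (e : ℕ → ℝ) (t : ℝ) :
    ∑ k ∈ Finset.range (S.card + 1), t ^ k * pE S e k =
      ∏ i ∈ S, (t * e i + (1 - e i)) := by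
  rw [Finset.prod_add, ← Finset.sum_fiberwise_of_maps_to
    (g := Finset.card) (t := Finset.range (S.card + 1))]
  · refine Finset.sum_congr rfl fun k _ => ?_
    rw [pE, Finset.mul_sum]
    refine Finset.sum_congr rfl fun A hA => ?_
    rw [Finset.prod_mul_distrib, Finset.prod_const, (Finset.mem_filter.mp hA).2, mul_assoc]
  · intro A hA
    exact Finset.mem_range_succ_iff.mpr (Finset.card_le_card (Finset.mem_powerset.mp hA))

theorem pE_nonneg {S : Finset ℕ} {e : ℕ → ℝ} (he : ∀ i ∈ S, 0 ≤ e i ∧ e i ≤ 1) (k : ℕ) :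
    0 ≤ pE S e k := by
  refine Finset.sum_nonneg fun A hA => mul_nonneg (Finset.prod_nonneg fun i hi => ?_)
    (Finset.prod_nonneg fun j hj => ?_)
  · exact (he i (Finset.mem_powerset.mp (Finset.mem_filter.mp hA).1 hi)).1
  · exact sub_nonneg.mpr (he j (Finset.mem_sdiff.mp hj).1).2

/-- Markov's inequality for `t ^ X`, where `X` counts the errors. -/
theorem pow_mul_epsE_le {n : ℕ} (m : ℕ) {e : ℕ → ℝ}
    (he : ∀ i ∈ Finset.Icc 1 n, 0 ≤ e i ∧ e i ≤ 1) {t : ℝ} (ht : 1 ≤ t) :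
    t ^ m * epsE n e m ≤ ∏ i ∈ Finset.Icc 1 n, (t * e i + (1 - e i)) := by
  rw [← sum_pow_mul_pE, epsE, Finset.mul_sum]
  calc ∑ k ∈ Finset.Icc m n, t ^ m * pE (Finset.Icc 1 n) e k
      ≤ ∑ k ∈ Finset.Icc m n, t ^ k * pE (Finset.Icc 1 n) e k :=
        Finset.sum_le_sum fun k hk => mul_le_mul_of_nonneg_right
          (pow_le_pow_right₀ ht (Finset.mem_Icc.mp hk).1) (pE_nonneg he k)
    _ ≤ ∑ k ∈ Finset.range ((Finset.Icc 1 n).card + 1), t ^ k * pE (Finset.Icc 1 n) e k := by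
        refine Finset.sum_le_sum_of_subset_of_nonneg (fun k hk => ?_) fun k _ _ =>
          mul_nonneg (by positivity) (pE_nonneg he k)
        simpa [Nat.lt_succ_iff] using (Finset.mem_Icc.mp hk).2

theorem prod_mul_add_one_sub_le_exp {S : Finset ℕ} {e : ℕ → ℝ}
    (he : ∀ i ∈ S, 0 ≤ e i ∧ e i ≤ 1) {t : ℝ} (ht : 0 ≤ t) :
    ∏ i ∈ S, (t * e i + (1 - e i)) ≤ Real.exp ((t - 1) * ∑ i ∈ S, e i) := by
  rw [Finset.mul_sum, Real.exp_sum]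
  refine Finset.prod_le_prod (fun i hi => ?_) fun i _ => ?_
  · exact add_nonneg (mul_nonneg ht (he i hi).1) (sub_nonneg.mpr (he i hi).2)
  · linarith [Real.add_one_le_exp ((t - 1) * e i)]

/-- Chernoff bound for the Poisson binomial tail. -/
theorem stmt7 (n m : ℕ) (hm1 : 1 ≤ m) (hmn : m ≤ n)
    (e : ℕ → ℝ) (he : ∀ i ∈ Finset.Icc 1 n, 0 ≤ e i ∧ e i ≤ 1)
    (μ : ℝ) (hμ : μ = ∑ i ∈ Finset.Icc 1 n, e i) (hμ0 : 0 < μ) (hμm : μ ≤ m) :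
    epsE n e m ≤ Real.exp ((m : ℝ) - μ) * (μ / m) ^ m := by
  have ht : 1 ≤ (m : ℝ) / μ := (one_le_div hμ0).mpr hμm
  have hm : (0 : ℝ) < m := by exact_mod_cast hm1
  have h := (pow_mul_epsE_le m he ht).trans
    (prod_mul_add_one_sub_le_exp he (zero_le_one.trans ht))
  rw [← hμ, sub_mul, div_mul_cancel₀ _ hμ0.ne', one_mul] at h
  rw [← inv_div (m : ℝ) μ, inv_pow, ← div_eq_mul_inv, le_div_iff₀ (by positivity), mul_comm]
  exact h
end

section
/- For real numbers ē, r with 0 < ē ≤ 1 and 0 < r ≤ 1, define λ(ē,r) = e^{r−ē} · (ē/r)^r, where e denotes Euler's number. Then: (i) if ē ≠ r then 0 < λ(ē,r) < 1, and λ(r,r) = 1; (ii) for fixed r, the map ē ↦ λ(ē,r) is strictly increasing on the interval (0, r); (iii) for fixed ē, the map r ↦ λ(ē,r) is strictly decreasing on the interval (ē, 1]. -/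
/-- `λ(ē, r) = e^(r - ē) · (ē/r)^r`. -/
noncomputable def lam (eb r : ℝ) : ℝ := Real.exp (r - eb) * (eb / r) ^ r

theorem lam_eq_exp {eb r : ℝ} (heb : 0 < eb) (hr : 0 < r) :
    lam eb r = Real.exp (r - eb + r * (Real.log eb - Real.log r)) := by
  rw [lam, Real.rpow_def_of_pos (div_pos heb hr), ← Real.exp_add,
    Real.log_div heb.ne' hr.ne', mul_comm r]

/-- The strict tangent-line bound for the logarithm, `log (x / y) < x / y - 1`, cleared of
denominators. -/
theorem mul_log_sub_log_lt {x y : ℝ} (hx : 0 < x) (hy : 0 < y) (hxy : x ≠ y) :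
    y * (Real.log x - Real.log y) < x - y := by
  have h := Real.log_lt_sub_one_of_pos (div_pos hx hy) (mt (div_eq_one_iff_eq hy.ne').mp hxy)
  rw [Real.log_div hx.ne' hy.ne'] at h
  calc y * (Real.log x - Real.log y) < y * (x / y - 1) := mul_lt_mul_of_pos_left h hy
    _ = x - y := by field_simp

theorem lam_self {r : ℝ} (hr : 0 < r) : lam r r = 1 := by
  simp [lam_eq_exp hr hr]

theorem lam_pos {eb r : ℝ} (heb : 0 < eb) (hr : 0 < r) : 0 < lam eb r := by
  rw [lam_eq_exp heb hr]
  exact Real.exp_pos _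

theorem lam_lt_one {eb r : ℝ} (heb : 0 < eb) (hr : 0 < r) (hne : eb ≠ r) : lam eb r < 1 := by
  rw [lam_eq_exp heb hr, Real.exp_lt_one_iff]
  linarith [mul_log_sub_log_lt heb hr hne]

theorem strictMonoOn_lam_left (r : ℝ) : StrictMonoOn (fun x : ℝ => lam x r) (Set.Ioo 0 r) := by
  rintro x ⟨hx, hxr⟩ y ⟨hy, hyr⟩ hxy
  have hr := hx.trans hxr
  simp only [lam_eq_exp hx hr, lam_eq_exp hy hr, Real.exp_lt_exp]
  have h := mul_log_sub_log_lt hx hy hxy.ne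
  have hlog := Real.log_lt_log hx hxy
  nlinarith [mul_pos (sub_pos.mpr hyr) (sub_pos.mpr hlog)]

theorem strictAntiOn_lam_right {eb : ℝ} (heb : 0 < eb) :
    StrictAntiOn (fun y : ℝ => lam eb y) (Set.Ioi eb) := by
  intro y hy z hz hyz
  have hy0 := heb.trans hy
  have hz0 := heb.trans hz
  simp only [lam_eq_exp heb hy0, lam_eq_exp heb hz0, Real.exp_lt_exp]
  have h := mul_log_sub_log_lt hy0 hz0 hyz.ne
  have hlog := Real.log_lt_log heb hy
  nlinarith [mul_pos (sub_pos.mpr hyz) (sub_pos.mpr hlog)]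

theorem stmt9 (eb r : ℝ) (heb0 : 0 < eb) (heb1 : eb ≤ 1)
    (hr0 : 0 < r) (hr1 : r ≤ 1) :
    ((eb ≠ r → 0 < lam eb r ∧ lam eb r < 1) ∧ lam r r = 1) ∧
    StrictMonoOn (fun x : ℝ => lam x r) (Set.Ioo 0 r) ∧
    StrictAntiOn (fun y : ℝ => lam eb y) (Set.Ioc eb 1) := by
  exact ⟨⟨fun hne => ⟨lam_pos heb0 hr0, lam_lt_one heb0 hr0 hne⟩, lam_self hr0⟩,
    strictMonoOn_lam_left r,
    (strictAntiOn_lam_right heb0).mono Set.Ioc_subset_Ioi_self⟩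
end

section
/- Let n ≥ 2, let m be an integer with 2 ≤ m ≤ n, and let ē, f, f' ∈ ℝ. Then ε(n,m,ē,f') − ε(n,m,ē,f) = (f' − f) · ( p(n−2, m−2, ē) − p(n−2, m−1, ē) ), where p(N,k,ē) = C(N,k) ē^k (1−ē)^{N−k}. In particular ε(n,m,ē,f) is an affine function of f whose slope is p(n−2,m−2,ē) − p(n−2,m−1,ē). -/
/-- The joint factor for the correlated pair of classifiers `n-1` and `n`
(identically distributed case, common error rate `eb`). -/
noncomputable def gpair (n : ℕ) (eb f : ℝ) (A : Finset ℕ) : ℝ :=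
  if n - 1 ∈ A ∧ n ∈ A then f
  else if n - 1 ∈ A ∨ n ∈ A then eb - f
  else 1 - 2 * eb + f

/-- Correlated-pair probability (identically distributed case) that exactly
`k` of the `n` classifiers err, where the pair `(n-1, n)` has joint error
probability `f`. -/
noncomputable def pCorI (n : ℕ) (eb f : ℝ) (k : ℕ) : ℝ :=
  ∑ A ∈ (Finset.Icc 1 n).powerset.filter (fun A => A.card = k),
    eb ^ (A ∩ Finset.Icc 1 (n - 2)).card *
      (1 - eb) ^ ((n - 2) - (A ∩ Finset.Icc 1 (n - 2)).card) * gpair n eb f A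

/-- Correlated-pair tail probability: at least `m` errors out of `n`. -/
noncomputable def epsCor (n m : ℕ) (eb f : ℝ) : ℝ :=
  ∑ k ∈ Finset.Icc m n, pCorI n eb f k

/-- The binomial probability of `k`, as a sum over the `k`-element subsets of `{1, …, N}`. -/
theorem sum_powerset_card_eq_pBin (N k : ℕ) (eb c : ℝ) :
    ∑ B ∈ (Finset.Icc 1 N).powerset,
      (if B.card = k then eb ^ B.card * (1 - eb) ^ (N - B.card) * c else 0) =
      pBin N k eb * c := by
  rw [Finset.sum_powerset_apply_card
    (fun j => if j = k then eb ^ j * (1 - eb) ^ (N - j) * c else 0)]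
  simp only [Nat.card_Icc, Nat.add_sub_cancel, smul_ite, smul_zero, nsmul_eq_mul,
    Finset.sum_ite_eq', Finset.mem_range, pBin]
  split_ifs with h
  · ring
  · simp [Nat.choose_eq_zero_of_lt (show N < k by omega)]

theorem pCorI_add_two (N j : ℕ) (eb f : ℝ) :
    pCorI (N + 2) eb f (j + 2) =
      pBin N j eb * f + 2 * (pBin N (j + 1) eb * (eb - f)) +
        pBin N (j + 2) eb * (1 - 2 * eb + f) := by
  have hI : Finset.Icc 1 (N + 2) = insert (N + 2) (insert (N + 1) (Finset.Icc 1 N)) := by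
    ext x
    simp only [Finset.mem_Icc, Finset.mem_insert]
    omega
  have h1 : N + 1 ∉ Finset.Icc 1 N := by simp
  have h2 : N + 2 ∉ insert (N + 1) (Finset.Icc 1 N) := by simp
  rw [pCorI, Finset.sum_filter, hI, Finset.sum_powerset_insert h2,
    Finset.sum_powerset_insert h1, Finset.sum_powerset_insert h1, two_mul,
    ← sum_powerset_card_eq_pBin, ← sum_powerset_card_eq_pBin, ← sum_powerset_card_eq_pBin]
  simp only [← Finset.sum_add_distrib]
  refine Finset.sum_congr rfl fun B hB => ?_
  have hB := Finset.mem_powerset.mp hB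
  have hB1 : N + 1 ∉ B := fun h => h1 (hB h)
  have hB2 : N + 2 ∉ B := fun h => h2 (Finset.mem_insert_of_mem (hB h))
  have hB2' : N + 2 ∉ insert (N + 1) B := by simp [hB2]
  have hI2 : N + 2 ∉ Finset.Icc 1 N := by simp
  have hBI : B ∩ Finset.Icc 1 N = B := Finset.inter_eq_left.mpr hB
  simp only [Nat.add_sub_cancel, Finset.insert_inter_of_notMem h1,
    Finset.insert_inter_of_notMem hI2, hBI, Finset.card_insert_of_notMem hB1,
    Finset.card_insert_of_notMem hB2, Finset.card_insert_of_notMem hB2', gpair,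
    show N + 2 - 1 = N + 1 by omega, Finset.mem_insert, hB1, hB2, or_true,
    or_false, and_true, and_false, if_true, if_false,
    show B.card + 1 = j + 2 ↔ B.card = j + 1 by omega,
    show B.card + 1 + 1 = j + 2 ↔ B.card = j by omega,
    show N + 1 ≠ N + 2 by omega, show N + 2 ≠ N + 1 by omega]
  ring

theorem pBin_eq_zero_of_lt {N k : ℕ} (h : N < k) (eb : ℝ) : pBin N k eb = 0 := by
  simp [pBin, Nat.choose_eq_zero_of_lt h]

theorem stmt13 (n m : ℕ) (hn : 2 ≤ n) (hm2 : 2 ≤ m) (hmn : m ≤ n)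
    (eb f f' : ℝ) :
    epsCor n m eb f' - epsCor n m eb f =
      (f' - f) * (pBin (n - 2) (m - 2) eb - pBin (n - 2) (m - 1) eb) := by
  obtain ⟨N, rfl⟩ := Nat.exists_eq_add_of_le' hn
  obtain ⟨M, rfl⟩ := Nat.exists_eq_add_of_le' hm2
  have hMN : M ≤ N + 1 := by omega
  have htel := Finset.sum_Ico_sub
    (fun j => pBin N (j + 1) eb - pBin N j eb) hMN
  rw [pBin_eq_zero_of_lt (by omega : N < N + 1 + 1),
    pBin_eq_zero_of_lt (by omega : N < N + 1)] at htel
  have hshift : Finset.Icc (M + 2) (N + 2) = Finset.Ico (M + 2) (N + 1 + 2) := by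
    ext x
    simp only [Finset.mem_Icc, Finset.mem_Ico]
    omega
  rw [epsCor, epsCor, ← Finset.sum_sub_distrib, hshift, ← Finset.sum_Ico_add']
  simp only [Nat.add_sub_cancel, show M + 2 - 1 = M + 1 by omega, pCorI_add_two]
  rw [show pBin N M eb - pBin N (M + 1) eb = 0 - 0 - (pBin N (M + 1) eb - pBin N M eb) by ring,
    ← htel, Finset.mul_sum]
  refine Finset.sum_congr rfl fun j _ => ?_
  ring
end

section
/- Let n, m ∈ ℕ with 3 ≤ m ≤ n and n ≥ 4, set r = (m−2)/(n−2), and let ē, f ∈ ℝ satisfy 0 < ē < r, 0 ≤ f ≤ ē and 2ē − f ≤ 1. Define λ = e^{r−ē} · (ē/r)^r (where e denotes Euler's number). Then ε(n,m,ē,f) ≤ λ^{n−2}. -/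
open Finset in
/-- The weights of a sum over all subsets of `{1, …, N + 2}` whose first factor only depends on
`A ∩ {1, …, N}`: the four values of the pair factor add up to `1`. -/
lemma sum_powerset_mul_gpair (N : ℕ) (eb f : ℝ) (F : Finset ℕ → ℝ) :
    ∑ A ∈ (Icc 1 (N + 2)).powerset, F (A ∩ Icc 1 N) * gpair (N + 2) eb f A =
      ∑ B ∈ (Icc 1 N).powerset, F B := by
  have hIcc : Icc 1 (N + 2) = insert (N + 2) (insert (N + 1) (Icc 1 N)) := by
    ext x; simp only [mem_Icc, mem_insert]; omega
  have h1 : N + 1 ∉ Icc 1 N := by simp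
  have h2 : N + 2 ∉ insert (N + 1) (Icc 1 N) := by simp
  rw [hIcc, sum_powerset_insert h2, sum_powerset_insert h1, sum_powerset_insert h1,
    ← sum_add_distrib, ← sum_add_distrib, ← sum_add_distrib]
  refine sum_congr rfl fun B hB => ?_
  rw [mem_powerset] at hB
  have hB1 : N + 1 ∉ B := fun h => h1 (hB h)
  have hB2 : N + 2 ∉ B := fun h => h2 (mem_insert_of_mem (hB h))
  have h2' : N + 2 ∉ Icc 1 N := by simp
  rw [insert_inter_of_notMem h2', insert_inter_of_notMem h2', insert_inter_of_notMem h1,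
    inter_eq_left.mpr hB]
  simp [gpair, hB1, hB2]
  ring

lemma gpair_nonneg (n : ℕ) {eb f : ℝ} (hf0 : 0 ≤ f) (hfe : f ≤ eb) (h2ef : 2 * eb - f ≤ 1)
    (A : Finset ℕ) : 0 ≤ gpair n eb f A := by
  unfold gpair
  split_ifs <;> linarith

open Finset in
/-- The tail probability as a single sum over subsets. -/
lemma epsCor_eq_sum_powerset (n m : ℕ) (eb f : ℝ) :
    epsCor n m eb f = ∑ A ∈ (Icc 1 n).powerset with m ≤ #A,
      eb ^ #(A ∩ Icc 1 (n - 2)) * (1 - eb) ^ ((n - 2) - #(A ∩ Icc 1 (n - 2))) *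
        gpair n eb f A := by
  unfold epsCor pCorI
  have hmaps : ∀ A ∈ (Icc 1 n).powerset.filter (fun A => m ≤ #A), #A ∈ Icc m n := by
    intro A hA
    rw [mem_filter, mem_powerset] at hA
    have := card_le_card hA.1
    rw [Nat.card_Icc] at this
    rw [mem_Icc]
    omega
  rw [← sum_fiberwise_of_maps_to hmaps]
  refine sum_congr rfl fun k hk => ?_
  rw [filter_filter]
  refine sum_congr (filter_congr fun A _ => ?_) fun _ _ => rfl
  rw [mem_Icc] at hk
  constructor
  · intro h; omega
  · exact And.right

open Finset in
/-- Exponential-moment bound on the tail: for `t ≥ 1`, the tail is controlled by the generating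
function of the number of errors among the `N` independent classifiers. -/
lemma epsCor_mul_pow_le (N j : ℕ) {eb f t : ℝ} (heb0 : 0 ≤ eb) (heb1 : eb ≤ 1) (hf0 : 0 ≤ f)
    (hfe : f ≤ eb) (h2ef : 2 * eb - f ≤ 1) (ht : 1 ≤ t) :
    epsCor (N + 2) (j + 2) eb f * t ^ j ≤ (t * eb + (1 - eb)) ^ N := by
  have ht0 : 0 ≤ t := zero_le_one.trans ht
  have h1e : 0 ≤ 1 - eb := sub_nonneg.mpr heb1
  have hg := gpair_nonneg (N + 2) hf0 hfe h2ef
  calc epsCor (N + 2) (j + 2) eb f * t ^ j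
      ≤ ∑ A ∈ (Icc 1 (N + 2)).powerset with j + 2 ≤ #A,
          (t * eb) ^ #(A ∩ Icc 1 N) * (1 - eb) ^ (N - #(A ∩ Icc 1 N)) *
            gpair (N + 2) eb f A := by
        rw [epsCor_eq_sum_powerset, sum_mul]
        refine sum_le_sum fun A hA => ?_
        rw [mem_filter, mem_powerset] at hA
        obtain ⟨hA, hcard⟩ := hA
        have hsub : A ⊆ (A ∩ Icc 1 N) ∪ {N + 1, N + 2} := by
          intro x hx
          have := hA hx
          simp only [mem_Icc, mem_union, mem_inter, mem_insert, mem_singleton] at this ⊢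
          by_cases hxN : x ≤ N
          · exact Or.inl ⟨hx, this.1, hxN⟩
          · omega
        have hj : j ≤ #(A ∩ Icc 1 N) := by
          have := (card_le_card hsub).trans (card_union_le _ _)
          have := card_le_two (a := N + 1) (b := N + 2)
          omega
        have hpow : t ^ j ≤ t ^ #(A ∩ Icc 1 N) := pow_le_pow_right₀ ht hj
        rw [Nat.add_sub_cancel, mul_pow]
        have hw : 0 ≤ eb ^ #(A ∩ Icc 1 N) * (1 - eb) ^ (N - #(A ∩ Icc 1 N)) *
            gpair (N + 2) eb f A := by
          have := hg A
          positivity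
        refine (mul_le_mul_of_nonneg_left hpow hw).trans_eq ?_
        ring
    _ ≤ ∑ A ∈ (Icc 1 (N + 2)).powerset,
          (t * eb) ^ #(A ∩ Icc 1 N) * (1 - eb) ^ (N - #(A ∩ Icc 1 N)) *
            gpair (N + 2) eb f A := by
        refine sum_le_sum_of_subset_of_nonneg (filter_subset _ _) fun A _ _ => ?_
        have := hg A
        positivity
    _ = (t * eb + (1 - eb)) ^ N := by
        rw [sum_powerset_mul_gpair N eb f fun B => (t * eb) ^ #B * (1 - eb) ^ (N - #B)]
        simpa using sum_pow_mul_eq_add_pow (t * eb) (1 - eb) (Icc 1 N)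

theorem stmt15 (n m : ℕ) (hm3 : 3 ≤ m) (hmn : m ≤ n) (hn4 : 4 ≤ n)
    (r : ℝ) (hr : r = ((m : ℝ) - 2) / ((n : ℝ) - 2))
    (eb f : ℝ) (heb0 : 0 < eb) (hebr : eb < r)
    (hf0 : 0 ≤ f) (hfe : f ≤ eb) (h2ef : 2 * eb - f ≤ 1)
    (lam : ℝ) (hlam : lam = Real.exp (r - eb) * (eb / r) ^ r) :
    epsCor n m eb f ≤ lam ^ (n - 2) := by
  obtain ⟨N, rfl⟩ := Nat.exists_eq_add_of_le' (show 2 ≤ n by omega)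
  obtain ⟨j, rfl⟩ := Nat.exists_eq_add_of_le' (show 2 ≤ m by omega)
  have hN : (0 : ℝ) < N := by exact_mod_cast (show 0 < N by omega)
  have hjN : (j : ℝ) ≤ N := by exact_mod_cast (show j ≤ N by omega)
  push_cast at hr
  rw [add_sub_cancel_right, add_sub_cancel_right] at hr
  have hr0 : 0 < r := heb0.trans hebr
  have hr1 : r ≤ 1 := hr ▸ div_le_one_of_le₀ hjN hN.le
  have hrN : r * N = j := by rw [hr]; field_simp
  have hmgf := epsCor_mul_pow_le N j heb0.le (hebr.le.trans hr1) hf0 hfe h2ef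
    ((one_le_div heb0).mpr hebr.le)
  rw [div_mul_cancel₀ r heb0.ne'] at hmgf
  have hbase : (r + (1 - eb)) ^ N ≤ Real.exp (r - eb) ^ N := by
    refine pow_le_pow_left₀ (by linarith) ?_ N
    linarith [Real.add_one_le_exp (r - eb)]
  have hpow : lam ^ N = Real.exp (r - eb) ^ N * (eb / r) ^ j := by
    rw [hlam, mul_pow, ← Real.rpow_mul_natCast (by positivity), hrN, Real.rpow_natCast]
  rw [Nat.add_sub_cancel, hpow, ← inv_div r eb, inv_pow, ← div_eq_mul_inv,
    le_div_iff₀ (by positivity)]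
  exact hmgf.trans hbase
end

section
/- Let n, m ∈ ℕ with 1 ≤ m < n, let ē ∈ ℝ with 0 < ē < 1, set r = m/n, and define ω = (ē/r)^r · ((1−ē)/(1−r))^{1−r}. Then: (i) C(n−1, m−1) · ē^{m−1} (1−ē)^{n−m} ≤ (r/ē) · ω^n; (ii) if ē ≠ r then ω < 1. -/
theorem choose_mul_pow_mul_pow_le_one {p : ℝ} (hp0 : 0 ≤ p) (hp1 : p ≤ 1) {n m : ℕ}
    (hmn : m ≤ n) : (n.choose m : ℝ) * p ^ m * (1 - p) ^ (n - m) ≤ 1 := by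
  have hq : 0 ≤ 1 - p := by linarith
  have hsum := add_pow p (1 - p) n
  rw [add_sub_cancel, one_pow] at hsum
  calc (n.choose m : ℝ) * p ^ m * (1 - p) ^ (n - m)
      = p ^ m * (1 - p) ^ (n - m) * (n.choose m : ℝ) := by ring
    _ ≤ ∑ k ∈ Finset.range (n + 1), p ^ k * (1 - p) ^ (n - k) * (n.choose k : ℝ) :=
      Finset.single_le_sum
      (f := fun k => p ^ k * (1 - p) ^ (n - k) * (n.choose k : ℝ))
      (fun k _ => by positivity) (Finset.mem_range.2 (by omega))
    _ = 1 := hsum.symm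

theorem rpow_mul_rpow_one_sub_pow {a b : ℝ} (ha : 0 ≤ a) (hb : 0 ≤ b) {n m : ℕ}
    (hn : n ≠ 0) (hmn : m ≤ n) :
    (a ^ ((m : ℝ) / n) * b ^ (1 - (m : ℝ) / n)) ^ n = a ^ m * b ^ (n - m) := by
  have hn' : (n : ℝ) ≠ 0 := by exact_mod_cast hn
  have hsub : (1 - (m : ℝ) / n) * n = ((n - m : ℕ) : ℝ) := by
    rw [Nat.cast_sub hmn]
    field_simp
  rw [mul_pow, ← Real.rpow_mul_natCast ha, ← Real.rpow_mul_natCast hb, hsub,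
    div_mul_cancel₀ _ hn', Real.rpow_natCast, Real.rpow_natCast]

theorem rpow_div_mul_rpow_div_lt_one {p q : ℝ} (hp0 : 0 < p) (hp1 : p < 1) (hq0 : 0 < q)
    (hq1 : q < 1) (hpq : p ≠ q) :
    (p / q) ^ q * ((1 - p) / (1 - q)) ^ (1 - q) < 1 := by
  have hp : 0 < 1 - p := by linarith
  have hq : 0 < 1 - q := by linarith
  have hne : p / q ≠ (1 - p) / (1 - q) := by
    rw [Ne, div_eq_div_iff hq0.ne' hq.ne']
    intro h
    exact hpq (by linarith)
  have hlt := (Real.geom_mean_lt_arith_mean2_weighted_iff_of_pos hq0 hq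
    (div_pos hp0 hq0).le (div_pos hp hq).le (by ring)).2 hne
  rwa [mul_div_cancel₀ _ hq0.ne', mul_div_cancel₀ _ hq.ne', add_sub_cancel] at hlt

theorem stmt19 (n m : ℕ) (hm1 : 1 ≤ m) (hmn : m < n)
    (eb : ℝ) (h0 : 0 < eb) (h1 : eb < 1)
    (r om : ℝ) (hr : r = (m : ℝ) / n)
    (hom : om = (eb / r) ^ r * ((1 - eb) / (1 - r)) ^ (1 - r)) :
    (((n - 1).choose (m - 1) : ℝ) * eb ^ (m - 1) * (1 - eb) ^ (n - m) ≤
      (r / eb) * om ^ n) ∧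
    (eb ≠ r → om < 1) := by
  have hm : (0 : ℝ) < m := by exact_mod_cast hm1
  have hn : (0 : ℝ) < n := by exact_mod_cast (by omega : 0 < n)
  have hr0 : 0 < r := hr ▸ div_pos hm hn
  have hr1 : r < 1 := by
    rw [hr, div_lt_one hn]
    exact_mod_cast hmn
  have hs : 0 < 1 - r := by linarith
  have he : 0 < 1 - eb := by linarith
  refine ⟨?_, fun hne => hom ▸ rpow_div_mul_rpow_div_lt_one h0 h1 hr0 hr1 hne⟩
  have hpow : om ^ n = (eb / r) ^ m * ((1 - eb) / (1 - r)) ^ (n - m) := by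
    have := rpow_mul_rpow_one_sub_pow (div_pos h0 hr0).le (div_pos he hs).le
      (by omega : n ≠ 0) hmn.le
    rwa [← hr, ← hom] at this
  have hchoose : ((n - 1).choose (m - 1) : ℝ) = r * n.choose m := by
    have h := Nat.add_one_mul_choose_eq (n - 1) (m - 1)
    rw [Nat.sub_add_cancel (by omega : 1 ≤ n), Nat.sub_add_cancel hm1] at h
    have h' : (n : ℝ) * (n - 1).choose (m - 1) = n.choose m * m := by exact_mod_cast h
    rw [hr]
    field_simp
    linarith
  have hpred : eb ^ (m - 1) = eb ^ m / eb := by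
    rw [eq_div_iff h0.ne', pow_sub_one_mul (by omega)]
  calc ((n - 1).choose (m - 1) : ℝ) * eb ^ (m - 1) * (1 - eb) ^ (n - m)
      = r / eb * om ^ n * (n.choose m * r ^ m * (1 - r) ^ (n - m)) := by
        rw [hchoose, hpred, hpow, div_pow, div_pow]
        field_simp
    _ ≤ r / eb * om ^ n := by
        refine mul_le_of_le_one_right ?_ (choose_mul_pow_mul_pow_le_one hr0.le hr1.le hmn.le)
        rw [hpow]
        positivity
end
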